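/- Let a, b > 0 and s ∈ ℝ. The double integral ∫₀^∞ ∫₀^∞ (x+y)^s f_{a,b}(x) f_{a,b}(y) dx dy is finite if and only if −2a < s < b. -/

import Mathlib

open MeasureTheory Set

/-- The beta prime density with parameters `a, b`. -/
noncomputable def betaPrimeDensity (a b x : ℝ) : ℝ :=
  Real.Gamma (a + b) / (Real.Gamma a * Real.Gamma b) * x ^ (a - 1) * (1 + x) ^ (-(a + b))

theorem setLIntegral_Ioi_one_rpow_lt_top_iff (r : ℝ) :
    ∫⁻ x in Ioi (1 : ℝ), ENNReal.ofReal (x ^ r) < ⊤ ↔ r < -1 := by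
  rw [← integrableOn_Ioi_rpow_iff (zero_lt_one' ℝ), lt_top_iff_ne_top]
  refine lintegral_ofReal_ne_top_iff_integrable (by fun_prop) ?_
  filter_upwards [ae_restrict_mem measurableSet_Ioi] with x hx
  exact Real.rpow_nonneg (zero_le_one.trans (le_of_lt hx)) r

theorem setLIntegral_Ioo_zero_one_rpow_lt_top_iff (r : ℝ) :
    ∫⁻ x in Ioo (0 : ℝ) 1, ENNReal.ofReal (x ^ r) < ⊤ ↔ -1 < r := by
  rw [← intervalIntegral.integrableOn_Ioo_rpow_iff (zero_lt_one' ℝ), lt_top_iff_ne_top]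
  refine lintegral_ofReal_ne_top_iff_integrable (by fun_prop) ?_
  filter_upwards [ae_restrict_mem measurableSet_Ioo] with x hx
  exact Real.rpow_nonneg hx.1.le r

theorem setLIntegral_Ioo_zero_rpow_sub_one {a x : ℝ} (ha : 0 < a) (hx : 0 < x) :
    ∫⁻ y in Ioo (0 : ℝ) x, ENNReal.ofReal (y ^ (a - 1)) = ENNReal.ofReal (x ^ a / a) := by
  have hint : IntegrableOn (fun y : ℝ => y ^ (a - 1)) (Ioo 0 x) :=
    (intervalIntegral.integrableOn_Ioo_rpow_iff hx).2 (by linarith)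
  rw [← ofReal_integral_eq_lintegral_ofReal hint, ← integral_Ioc_eq_integral_Ioo,
    ← intervalIntegral.integral_of_le hx.le, integral_rpow (Or.inl (by linarith))]
  · simp [Real.zero_rpow ha.ne']
  · filter_upwards [ae_restrict_mem measurableSet_Ioo] with y hy
    exact Real.rpow_nonneg hy.1.le _

theorem measurable_betaPrimeDensity (a b : ℝ) : Measurable (betaPrimeDensity a b) := by
  unfold betaPrimeDensity
  fun_prop

/-- The normalizing constant of the beta prime density is positive. -/
theorem betaPrime_const_pos {a b : ℝ} (ha : 0 < a) (hb : 0 < b) :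
    0 < Real.Gamma (a + b) / (Real.Gamma a * Real.Gamma b) :=
  div_pos (Real.Gamma_pos_of_pos (add_pos ha hb))
    (mul_pos (Real.Gamma_pos_of_pos ha) (Real.Gamma_pos_of_pos hb))

theorem betaPrimeDensity_pos {a b x : ℝ} (ha : 0 < a) (hb : 0 < b) (hx : 0 < x) :
    0 < betaPrimeDensity a b x := by
  have := betaPrime_const_pos ha hb
  unfold betaPrimeDensity
  positivity

theorem betaPrimeDensity_le_near_zero {a b x : ℝ} (ha : 0 < a) (hb : 0 < b) (hx : 0 < x) :
    betaPrimeDensity a b x ≤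
      Real.Gamma (a + b) / (Real.Gamma a * Real.Gamma b) * x ^ (a - 1) := by
  have := betaPrime_const_pos ha hb
  exact mul_le_of_le_one_right (by positivity)
    (Real.rpow_le_one_of_one_le_of_nonpos (by linarith) (by linarith))

theorem le_betaPrimeDensity_near_zero {a b x : ℝ} (ha : 0 < a) (hb : 0 < b) (hx : 0 < x)
    (hx1 : x < 1) :
    Real.Gamma (a + b) / (Real.Gamma a * Real.Gamma b) * 2 ^ (-(a + b)) * x ^ (a - 1) ≤
      betaPrimeDensity a b x := by
  have := betaPrime_const_pos ha hb
  unfold betaPrimeDensity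
  rw [mul_right_comm]
  gcongr ?_ * ?_
  exact Real.rpow_le_rpow_of_nonpos (by linarith) (by linarith) (by linarith)

theorem betaPrimeDensity_le_near_top {a b x : ℝ} (ha : 0 < a) (hb : 0 < b) (hx : 0 < x) :
    betaPrimeDensity a b x ≤
      Real.Gamma (a + b) / (Real.Gamma a * Real.Gamma b) * x ^ (-b - 1) := by
  have := betaPrime_const_pos ha hb
  have hpow : x ^ (-b - 1) = x ^ (a - 1) * x ^ (-(a + b)) := by
    rw [← Real.rpow_add hx]; ring_nf
  unfold betaPrimeDensity
  rw [hpow, ← mul_assoc]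
  gcongr ?_ * ?_
  exact Real.rpow_le_rpow_of_nonpos hx (by linarith) (by linarith)

theorem le_betaPrimeDensity_near_top {a b x : ℝ} (ha : 0 < a) (hb : 0 < b) (hx : 1 < x) :
    Real.Gamma (a + b) / (Real.Gamma a * Real.Gamma b) * 2 ^ (-(a + b)) * x ^ (-b - 1) ≤
      betaPrimeDensity a b x := by
  have := betaPrime_const_pos ha hb
  have hx0 : 0 < x := by linarith
  have hpow : x ^ (-b - 1) = x ^ (a - 1) * x ^ (-(a + b)) := by
    rw [← Real.rpow_add hx0]; ring_nf
  unfold betaPrimeDensity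
  calc _ = Real.Gamma (a + b) / (Real.Gamma a * Real.Gamma b) * x ^ (a - 1) *
        (2 * x) ^ (-(a + b)) := by
        rw [hpow, Real.mul_rpow two_pos.le hx0.le]; ring
    _ ≤ _ := by
        gcongr ?_ * ?_
        exact Real.rpow_le_rpow_of_nonpos (by linarith) (by linarith) (by linarith)

/-- Moments of order strictly between `-a` and `b` of the beta prime density are finite. -/
theorem betaPrime_moment_lt_top {a b t : ℝ} (ha : 0 < a) (hb : 0 < b) (hat : -a < t)
    (htb : t < b) :
    ∫⁻ x in Ioi (0 : ℝ), ENNReal.ofReal (x ^ t * betaPrimeDensity a b x) < ⊤ := by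
  have hK := betaPrime_const_pos ha hb
  set K := Real.Gamma (a + b) / (Real.Gamma a * Real.Gamma b)
  have hbound : ∀ {S : Set ℝ} {r : ℝ}, MeasurableSet S → S ⊆ Ioi 0 →
      (∀ x ∈ S, betaPrimeDensity a b x ≤ K * x ^ r) →
      ∫⁻ x in S, ENNReal.ofReal (x ^ (t + r)) < ⊤ →
      ∫⁻ x in S, ENNReal.ofReal (x ^ t * betaPrimeDensity a b x) < ⊤ := by
    intro S r hS hpos hle hfin
    calc _ ≤ ∫⁻ x in S, ENNReal.ofReal K * ENNReal.ofReal (x ^ (t + r)) := by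
          refine setLIntegral_mono' hS fun x hx => ?_
          have hx0 : 0 < x := hpos hx
          rw [← ENNReal.ofReal_mul hK.le, Real.rpow_add hx0, mul_left_comm]
          gcongr
          exact hle x hx
      _ = ENNReal.ofReal K * ∫⁻ x in S, ENNReal.ofReal (x ^ (t + r)) :=
          lintegral_const_mul _ (by fun_prop)
      _ < ⊤ := ENNReal.mul_lt_top ENNReal.ofReal_lt_top hfin
  have hzero := hbound (S := Ioo 0 1) (r := a - 1) measurableSet_Ioo (fun x hx => hx.1)
    (fun x hx => betaPrimeDensity_le_near_zero ha hb hx.1)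
    ((setLIntegral_Ioo_zero_one_rpow_lt_top_iff _).2 (by linarith))
  have htop := hbound (S := Ioi 1) (r := -b - 1) measurableSet_Ioi
    (Ioi_subset_Ioi zero_le_one)
    (fun x hx => betaPrimeDensity_le_near_top ha hb (zero_lt_one.trans hx))
    ((setLIntegral_Ioi_one_rpow_lt_top_iff _).2 (by linarith))
  rw [← Ioc_union_Ioi_eq_Ioi (zero_le_one' ℝ)]
  refine (lintegral_union_le _ _ _).trans_lt (ENNReal.add_lt_top.2 ⟨?_, htop⟩)
  rwa [← setLIntegral_congr Ioo_ae_eq_Ioc]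

/-- Moments of order at least `b` of the beta prime density are infinite. -/
theorem betaPrime_moment_eq_top {a b t : ℝ} (ha : 0 < a) (hb : 0 < b) (hbt : b ≤ t) :
    ∫⁻ x in Ioi (0 : ℝ), ENNReal.ofReal (x ^ t * betaPrimeDensity a b x) = ⊤ := by
  have hK := betaPrime_const_pos ha hb
  set K := Real.Gamma (a + b) / (Real.Gamma a * Real.Gamma b)
  have hc : 0 < K * 2 ^ (-(a + b)) := by positivity
  have htop : ∫⁻ x in Ioi (1 : ℝ), ENNReal.ofReal (x ^ (t + (-b - 1))) = ⊤ := by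
    rw [← not_lt_top_iff, setLIntegral_Ioi_one_rpow_lt_top_iff]
    linarith
  rw [eq_top_iff]
  calc ⊤ = ENNReal.ofReal (K * 2 ^ (-(a + b))) *
        ∫⁻ x in Ioi (1 : ℝ), ENNReal.ofReal (x ^ (t + (-b - 1))) := by
        rw [htop, ENNReal.mul_top (by simpa using hc)]
    _ = ∫⁻ x in Ioi (1 : ℝ),
        ENNReal.ofReal (K * 2 ^ (-(a + b))) * ENNReal.ofReal (x ^ (t + (-b - 1))) :=
        (lintegral_const_mul _ (by fun_prop)).symm
    _ ≤ ∫⁻ x in Ioi (1 : ℝ), ENNReal.ofReal (x ^ t * betaPrimeDensity a b x) := by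
        refine setLIntegral_mono' measurableSet_Ioi fun x hx => ?_
        have hx0 : 0 < x := zero_lt_one.trans hx
        rw [← ENNReal.ofReal_mul hc.le, Real.rpow_add hx0, mul_left_comm]
        gcongr
        exact le_betaPrimeDensity_near_top ha hb hx
    _ ≤ _ := lintegral_mono_set (Ioi_subset_Ioi zero_le_one)

/-- The integral over the open quadrant of a product of weighted densities factorizes. -/
theorem setLIntegral_quadrant_rpow_mul_betaPrimeDensity {a b : ℝ} (ha : 0 < a) (hb : 0 < b)
    (t u : ℝ) :
    ∫⁻ p in Ioi (0 : ℝ) ×ˢ Ioi (0 : ℝ), ENNReal.ofReal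
        (p.1 ^ t * betaPrimeDensity a b p.1 * (p.2 ^ u * betaPrimeDensity a b p.2)) =
      (∫⁻ x in Ioi (0 : ℝ), ENNReal.ofReal (x ^ t * betaPrimeDensity a b x)) *
        ∫⁻ y in Ioi (0 : ℝ), ENNReal.ofReal (y ^ u * betaPrimeDensity a b y) := by
  have hm := measurable_betaPrimeDensity a b
  rw [← lintegral_prod_mul (by fun_prop) (by fun_prop), Measure.prod_restrict,
    ← Measure.volume_eq_prod]
  refine setLIntegral_congr_fun (measurableSet_Ioi.prod measurableSet_Ioi) fun p hp => ?_
  have hp1 : 0 < p.1 := hp.1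
  have := betaPrimeDensity_pos ha hb hp1
  exact ENNReal.ofReal_mul (by positivity)

theorem add_rpow_le_two_rpow_mul {x y s : ℝ} (hx : 0 < x) (hy : 0 < y) (hs : 0 ≤ s) :
    (x + y) ^ s ≤ 2 ^ s * (x ^ s + y ^ s) := by
  have hxs := Real.rpow_nonneg hx.le s
  have hys := Real.rpow_nonneg hy.le s
  rcases le_total x y with h | h
  · calc (x + y) ^ s ≤ (2 * y) ^ s := Real.rpow_le_rpow (by linarith) (by linarith) hs
      _ = 2 ^ s * y ^ s := Real.mul_rpow two_pos.le hy.le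
      _ ≤ _ := by gcongr; linarith
  · calc (x + y) ^ s ≤ (2 * x) ^ s := Real.rpow_le_rpow (by linarith) (by linarith) hs
      _ = 2 ^ s * x ^ s := Real.mul_rpow two_pos.le hx.le
      _ ≤ _ := by gcongr; linarith

theorem add_rpow_le_rpow_half_mul {x y s : ℝ} (hx : 0 < x) (hy : 0 < y) (hs : s ≤ 0) :
    (x + y) ^ s ≤ x ^ (s / 2) * y ^ (s / 2) := by
  have hsq : ((x + y) ^ (2 : ℝ)) ^ (s / 2) = (x + y) ^ s := by
    rw [← Real.rpow_mul (by positivity)]; ring_nf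
  rw [← Real.mul_rpow hx.le hy.le, ← hsq]
  refine Real.rpow_le_rpow_of_nonpos (by positivity) ?_ (by linarith)
  rw [Real.rpow_two]
  nlinarith [mul_pos hx hy]

theorem betaPrime_conv_mellin_lt_top_of_nonneg {a b s : ℝ} (ha : 0 < a) (hb : 0 < b)
    (hs : 0 ≤ s) (hsb : s < b) :
    ∫⁻ p in Ioi (0 : ℝ) ×ˢ Ioi (0 : ℝ), ENNReal.ofReal
        ((p.1 + p.2) ^ s * betaPrimeDensity a b p.1 * betaPrimeDensity a b p.2) < ⊤ := by
  have hm := measurable_betaPrimeDensity a b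
  have hM := betaPrime_moment_lt_top ha hb (by linarith : -a < s) hsb
  have hM0 := betaPrime_moment_lt_top ha hb (by linarith : -a < 0) hb
  calc _ ≤ ∫⁻ p in Ioi (0 : ℝ) ×ˢ Ioi (0 : ℝ), ENNReal.ofReal (2 ^ s) *
        (ENNReal.ofReal (p.1 ^ s * betaPrimeDensity a b p.1 *
            (p.2 ^ (0 : ℝ) * betaPrimeDensity a b p.2)) +
          ENNReal.ofReal (p.1 ^ (0 : ℝ) * betaPrimeDensity a b p.1 *
            (p.2 ^ s * betaPrimeDensity a b p.2))) := by
        refine setLIntegral_mono' (measurableSet_Ioi.prod measurableSet_Ioi) fun p hp => ?_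
        have hp1 : 0 < p.1 := hp.1
        have hp2 : 0 < p.2 := hp.2
        have hf1 := betaPrimeDensity_pos ha hb hp1
        have hf2 := betaPrimeDensity_pos ha hb hp2
        rw [← ENNReal.ofReal_add (by positivity) (by positivity),
          ← ENNReal.ofReal_mul (by positivity), Real.rpow_zero, Real.rpow_zero]
        refine ENNReal.ofReal_le_ofReal ?_
        calc _ ≤ 2 ^ s * (p.1 ^ s + p.2 ^ s) * betaPrimeDensity a b p.1 *
              betaPrimeDensity a b p.2 := by
              gcongr
              exact add_rpow_le_two_rpow_mul hp1 hp2 hs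
          _ = _ := by ring
    _ < ⊤ := by
        rw [lintegral_const_mul _ (by fun_prop), lintegral_add_left (by fun_prop),
          setLIntegral_quadrant_rpow_mul_betaPrimeDensity ha hb,
          setLIntegral_quadrant_rpow_mul_betaPrimeDensity ha hb]
        exact ENNReal.mul_lt_top ENNReal.ofReal_lt_top (ENNReal.add_lt_top.2
          ⟨ENNReal.mul_lt_top hM hM0, ENNReal.mul_lt_top hM0 hM⟩)

theorem betaPrime_conv_mellin_lt_top_of_nonpos {a b s : ℝ} (ha : 0 < a) (hb : 0 < b)
    (hs : s ≤ 0) (has : -2 * a < s) :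
    ∫⁻ p in Ioi (0 : ℝ) ×ˢ Ioi (0 : ℝ), ENNReal.ofReal
        ((p.1 + p.2) ^ s * betaPrimeDensity a b p.1 * betaPrimeDensity a b p.2) < ⊤ := by
  have hM := betaPrime_moment_lt_top ha hb (by linarith : -a < s / 2) (by linarith)
  refine lt_of_le_of_lt ?_ (ENNReal.mul_lt_top hM hM)
  rw [← setLIntegral_quadrant_rpow_mul_betaPrimeDensity ha hb]
  refine setLIntegral_mono' (measurableSet_Ioi.prod measurableSet_Ioi) fun p hp => ?_
  have hp1 : 0 < p.1 := hp.1
  have hp2 : 0 < p.2 := hp.2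
  have hf1 := betaPrimeDensity_pos ha hb hp1
  have hf2 := betaPrimeDensity_pos ha hb hp2
  refine ENNReal.ofReal_le_ofReal ?_
  rw [mul_mul_mul_comm, mul_assoc]
  gcongr
  exact add_rpow_le_rpow_half_mul hp1 hp2 hs

theorem betaPrime_conv_mellin_eq_top_of_le {a b s : ℝ} (ha : 0 < a) (hb : 0 < b)
    (hbs : b ≤ s) :
    ∫⁻ p in Ioi (0 : ℝ) ×ˢ Ioi (0 : ℝ), ENNReal.ofReal
        ((p.1 + p.2) ^ s * betaPrimeDensity a b p.1 * betaPrimeDensity a b p.2) = ⊤ := by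
  have hm := measurable_betaPrimeDensity a b
  have hmass : ∫⁻ y in Ioi (0 : ℝ), ENNReal.ofReal (y ^ (0 : ℝ) * betaPrimeDensity a b y) ≠ 0 := by
    refine (setLIntegral_pos_iff (by fun_prop)).2 ?_ |>.ne'
    refine lt_of_lt_of_le (by simp : 0 < volume (Ioi (0 : ℝ))) (measure_mono fun y hy => ⟨?_, hy⟩)
    simpa using betaPrimeDensity_pos ha hb hy
  rw [eq_top_iff, ← ENNReal.top_mul hmass, ← betaPrime_moment_eq_top ha hb hbs,
    ← setLIntegral_quadrant_rpow_mul_betaPrimeDensity ha hb]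
  refine setLIntegral_mono' (measurableSet_Ioi.prod measurableSet_Ioi) fun p hp => ?_
  have hp1 : 0 < p.1 := hp.1
  have hp2 : 0 < p.2 := hp.2
  have hf1 := betaPrimeDensity_pos ha hb hp1
  have hf2 := betaPrimeDensity_pos ha hb hp2
  refine ENNReal.ofReal_le_ofReal ?_
  rw [Real.rpow_zero, one_mul]
  gcongr
  · linarith
  · linarith

theorem betaPrime_conv_mellin_eq_top_of_le_neg {a b s : ℝ} (ha : 0 < a) (hb : 0 < b)
    (hsa : s ≤ -2 * a) :
    ∫⁻ p in Ioi (0 : ℝ) ×ˢ Ioi (0 : ℝ), ENNReal.ofReal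
        ((p.1 + p.2) ^ s * betaPrimeDensity a b p.1 * betaPrimeDensity a b p.2) = ⊤ := by
  have hm := measurable_betaPrimeDensity a b
  have hK := betaPrime_const_pos ha hb
  set K := Real.Gamma (a + b) / (Real.Gamma a * Real.Gamma b)
  set c := K * 2 ^ (-(a + b))
  have hc : 0 < c := by positivity
  have hC : 0 < 2 ^ s * c ^ 2 / a := by positivity
  have htop : ∫⁻ x in Ioo (0 : ℝ) 1, ENNReal.ofReal (x ^ (s + (a - 1) + a)) = ⊤ := by
    rw [← not_lt_top_iff, setLIntegral_Ioo_zero_one_rpow_lt_top_iff]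
    linarith
  rw [Measure.volume_eq_prod, ← Measure.prod_restrict, lintegral_prod _ (by fun_prop),
    eq_top_iff]
  calc ⊤ = ENNReal.ofReal (2 ^ s * c ^ 2 / a) *
        ∫⁻ x in Ioo (0 : ℝ) 1, ENNReal.ofReal (x ^ (s + (a - 1) + a)) := by
        rw [htop, ENNReal.mul_top (by simpa using hC)]
    _ = ∫⁻ x in Ioo (0 : ℝ) 1,
        ENNReal.ofReal (2 ^ s * c ^ 2 / a) * ENNReal.ofReal (x ^ (s + (a - 1) + a)) :=
        (lintegral_const_mul _ (by fun_prop)).symm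
    _ ≤ ∫⁻ x in Ioo (0 : ℝ) 1, ∫⁻ y in Ioi (0 : ℝ), ENNReal.ofReal
        ((x + y) ^ s * betaPrimeDensity a b x * betaPrimeDensity a b y) := by
        refine setLIntegral_mono' measurableSet_Ioo fun x hx => ?_
        have hx0 : 0 < x := hx.1
        have hD : 0 ≤ (2 * x) ^ s * (c * x ^ (a - 1)) * c := by positivity
        calc _ = ENNReal.ofReal ((2 * x) ^ s * (c * x ^ (a - 1)) * c) *
              ENNReal.ofReal (x ^ a / a) := by
              rw [← ENNReal.ofReal_mul hC.le, ← ENNReal.ofReal_mul hD,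
                Real.mul_rpow two_pos.le hx0.le, Real.rpow_add hx0, Real.rpow_add hx0]
              ring_nf
          _ = ∫⁻ y in Ioo 0 x, ENNReal.ofReal ((2 * x) ^ s * (c * x ^ (a - 1)) * c) *
              ENNReal.ofReal (y ^ (a - 1)) := by
              rw [lintegral_const_mul _ (by fun_prop), setLIntegral_Ioo_zero_rpow_sub_one ha hx0]
          _ ≤ ∫⁻ y in Ioo 0 x, ENNReal.ofReal
              ((x + y) ^ s * betaPrimeDensity a b x * betaPrimeDensity a b y) := by
              refine setLIntegral_mono' measurableSet_Ioo fun y hy => ?_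
              have hy0 : 0 < y := hy.1
              have hfx := betaPrimeDensity_pos ha hb hx0
              rw [← ENNReal.ofReal_mul hD, mul_assoc _ c]
              gcongr ENNReal.ofReal (?_ * ?_ * ?_)
              · exact Real.rpow_le_rpow_of_nonpos (by linarith) (by linarith [hy.2])
                  (by linarith)
              · exact le_betaPrimeDensity_near_zero ha hb hx0 hx.2
              · exact le_betaPrimeDensity_near_zero ha hb hy0 (hy.2.trans hx.2)
          _ ≤ _ := lintegral_mono_set Ioo_subset_Ioi_self
    _ ≤ _ := lintegral_mono_set Ioo_subset_Ioi_self

/-- The Mellin transform of the sum of two independent beta prime(a,b) random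
variables is finite if and only if `-2a < s < b` (Proposition 3). -/
theorem betaPrime_conv_mellin_finite (a b s : ℝ) (ha : 0 < a) (hb : 0 < b) :
    (∫⁻ p in (Ioi (0 : ℝ) ×ˢ Ioi (0 : ℝ)),
        ENNReal.ofReal ((p.1 + p.2) ^ s * betaPrimeDensity a b p.1 * betaPrimeDensity a b p.2)
      < ⊤)
      ↔ (-2 * a < s ∧ s < b) := by
  constructor
  · intro h
    constructor
    · by_contra! hs
      exact h.ne (betaPrime_conv_mellin_eq_top_of_le_neg ha hb hs)
    · by_contra! hs
      exact h.ne (betaPrime_conv_mellin_eq_top_of_le ha hb hs)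
  · rintro ⟨has, hsb⟩
    rcases le_total 0 s with hs | hs
    · exact betaPrime_conv_mellin_lt_top_of_nonneg ha hb hs hsb
    · exact betaPrime_conv_mellin_lt_top_of_nonpos ha hb hs has
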